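/- Let 0 < p ≤ ∞, 0 < α < min{1,p}, β > 0 and d ∈ ℕ, and write a_n = a_n(Id: G^{α,β,p}(T^d) → L2(T^d)). Then lim_{n→∞} a_n · exp(β · (vol(B_p^d))^{−α/d} · n^{α/d}) = 1, where B_p^d is the closed unit ball of ℓ_p^d and vol denotes Lebesgue volume. -/

import Mathlib

open MeasureTheory Real Filter
open scoped ENNReal NNReal BigOperators

noncomputable section

/-- The `d`-torus `T^d`, modeled as the cube `[0,2π]^d` with Lebesgue measure. -/
def torusMeasure (d : ℕ) : Measure (Fin d → ℝ) :=
  volume.restrict (Set.univ.pi fun _ => Set.Icc 0 (2 * π))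

/-- `L2(T^d)`. -/
abbrev TorusL2 (d : ℕ) := Lp ℂ 2 (torusMeasure d)

/-- The Fourier coefficient `c_k(f) = (2π)^{-d/2} ∫ f(x) e^{-i k·x} dx`. -/
def fourierCoeffT {d : ℕ} (f : TorusL2 d) (k : Fin d → ℤ) : ℂ :=
  (((2 * π) ^ (-(d : ℝ) / 2) : ℝ) : ℂ) *
    ∫ x, f x * Complex.exp (-Complex.I * ((∑ j, (k j : ℝ) * x j : ℝ) : ℂ)) ∂(torusMeasure d)

/-- The squared `H^w(T^d)` norm `∑_k w(k)^2 |c_k(f)|^2`, valued in `ℝ≥0∞`. -/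
def wNormSq {d : ℕ} (w : (Fin d → ℤ) → ℝ) (f : TorusL2 d) : ℝ≥0∞ :=
  ∑' k : Fin d → ℤ, ENNReal.ofReal (w k ^ 2 * ‖fourierCoeffT f k‖ ^ 2)

/-- The `n`-th approximation number `a_n(Id : H^{w₁}(T^d) → H^{w₂}(T^d))`: the infimum of all
worst-case error bounds `r ≥ 0` achievable by a linear map `A` of rank `< n`, where the error
`‖f - A f‖` is measured in the `H^{w₂}` norm on the unit ball of `H^{w₁}`.
(With `w₂ ≡ 1` this is the approximation error in `L2(T^d)`, by Parseval.) -/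
def approxNumber (d : ℕ) (w₁ w₂ : (Fin d → ℤ) → ℝ) (n : ℕ) : ℝ :=
  sInf { r : ℝ | 0 ≤ r ∧
    ∃ A : TorusL2 d →ₗ[ℂ] TorusL2 d,
      Module.Finite ℂ (LinearMap.range A) ∧
      Module.finrank ℂ (LinearMap.range A) < n ∧
      ∀ f : TorusL2 d, wNormSq w₁ f ≤ 1 →
        wNormSq w₂ (f - A f) ≤ ENNReal.ofReal r ^ 2 }

/-- constant weight `1`, defining `L2(T^d)` as a weighted space. -/
def constOne (d : ℕ) : (Fin d → ℤ) → ℝ := fun _ => 1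

/-- The `ℓ_p` (quasi-)norm on `ℝ^d`, for `0 < p ≤ ∞`. -/
def pNorm (d : ℕ) (p : ℝ≥0∞) (x : Fin d → ℝ) : ℝ :=
  if p = ∞ then ⨆ j, |x j| else (∑ j, |x j| ^ p.toReal) ^ (1 / p.toReal)

/-- The isotropic Sobolev weight `w_{s,p}`. -/
def wIso (d : ℕ) (s : ℝ) (p : ℝ≥0∞) (k : Fin d → ℤ) : ℝ :=
  if p = ∞ then (max 1 (⨆ j, |(k j : ℝ)|)) ^ s
  else (1 + ∑ j, |(k j : ℝ)| ^ p.toReal) ^ (s / p.toReal)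

/-- The Gevrey weight `w^G_{α,β,p}(k) = exp(β ‖k‖_p^α)`. -/
def wGevrey (d : ℕ) (α β : ℝ) (p : ℝ≥0∞) (k : Fin d → ℤ) : ℝ :=
  Real.exp (β * pNorm d p (fun j => (k j : ℝ)) ^ α)

/-- The covering number `N_ε(A)`: the minimal number of closed `ℓ_∞`-balls of radius `ε`
needed to cover `A` (note that on `Fin d → ℝ` the canonical metric is the sup-metric). -/
def coveringNumber {d : ℕ} (ε : ℝ) (A : Set (Fin d → ℝ)) : ℕ∞ :=
  ⨅ (S : Finset (Fin d → ℝ)) (_ : A ⊆ ⋃ x ∈ S, Metric.closedBall x ε), (S.card : ℕ∞)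

/-- The (non-dyadic) entropy number `ε_n(A, ℓ_∞^d)`. -/
def entropyNumber {d : ℕ} (n : ℕ) (A : Set (Fin d → ℝ)) : ℝ :=
  sInf { ε : ℝ | 0 < ε ∧ coveringNumber ε A ≤ (n : ℕ∞) }

/-- The grid number `G(A) = #(A ∩ ℤ^d)`. -/
def gridNumber {d : ℕ} (A : Set (Fin d → ℝ)) : ℕ∞ :=
  (A ∩ {x | ∀ i, ∃ m : ℤ, x i = (m : ℝ)}).encard

/-- The closed unit ball `B_p^d` of `ℓ_p^d`. -/
def unitBallP (d : ℕ) (p : ℝ≥0∞) : Set (Fin d → ℝ) := {x | pNorm d p x ≤ 1}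

end

noncomputable section

section PNorm

variable {d : ℕ} {p : ℝ≥0∞}

theorem pNorm_nonneg (x : Fin d → ℝ) : 0 ≤ pNorm d p x := by
  unfold pNorm
  split_ifs
  · exact Real.iSup_nonneg fun j => abs_nonneg _
  · positivity

theorem abs_le_pNorm (hp : 0 < p) (x : Fin d → ℝ) (j : Fin d) : |x j| ≤ pNorm d p x := by
  unfold pNorm
  split_ifs with h
  · exact le_ciSup (f := fun j => |x j|) (Set.finite_range _).bddAbove j
  · have hp' : 0 < p.toReal := ENNReal.toReal_pos hp.ne' h
    calc |x j| = (|x j| ^ p.toReal) ^ (1 / p.toReal) := by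
          rw [← Real.rpow_mul (abs_nonneg _), mul_one_div_cancel hp'.ne', Real.rpow_one]
      _ ≤ _ := by
          gcongr
          exact Finset.single_le_sum (f := fun j => |x j| ^ p.toReal)
            (fun i _ => by positivity) (Finset.mem_univ j)

theorem pNorm_mono {x y : Fin d → ℝ} (h : ∀ j, |x j| ≤ |y j|) : pNorm d p x ≤ pNorm d p y := by
  unfold pNorm
  split_ifs
  · exact ciSup_mono (Set.finite_range _).bddAbove h
  · exact Real.rpow_le_rpow (by positivity) (Finset.sum_le_sum fun j _ =>
      Real.rpow_le_rpow (abs_nonneg _) (h j) ENNReal.toReal_nonneg) (by positivity)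

theorem pNorm_smul (hp : 0 < p) {t : ℝ} (ht : 0 ≤ t) (x : Fin d → ℝ) :
    pNorm d p (t • x) = t * pNorm d p x := by
  unfold pNorm
  simp only [Pi.smul_apply, smul_eq_mul, abs_mul, abs_of_nonneg ht]
  split_ifs with h
  · rw [Real.mul_iSup_of_nonneg ht]
  · have hp' : 0 < p.toReal := ENNReal.toReal_pos hp.ne' h
    simp_rw [Real.mul_rpow ht (abs_nonneg _)]
    rw [← Finset.mul_sum, Real.mul_rpow (by positivity) (by positivity), ← Real.rpow_mul ht,
      mul_one_div_cancel hp'.ne', Real.rpow_one]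

theorem pNorm_top_add_le (x y : Fin d → ℝ) : pNorm d ∞ (x + y) ≤ pNorm d ∞ x + pNorm d ∞ y :=
  have h (z : Fin d → ℝ) (j : Fin d) : |z j| ≤ pNorm d ∞ z := abs_le_pNorm (by simp) z j
  calc pNorm d ∞ (x + y) = ⨆ j, |(x + y) j| := if_pos rfl
    _ ≤ _ := Real.iSup_le (fun j => (abs_add_le _ _).trans (add_le_add (h x j) (h y j)))
      (add_nonneg (pNorm_nonneg x) (pNorm_nonneg y))

/-- The `min 1 p`-triangle inequality of the `ℓ_p` quasi-norm. -/
theorem exists_pNorm_add_rpow_le (hp : 0 < p) {α : ℝ} (hα1 : α < 1)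
    (hαp : ENNReal.ofReal α < p) :
    ∃ q : ℝ, 0 < q ∧ α < q ∧ ∀ x y : Fin d → ℝ,
      pNorm d p (x + y) ^ q ≤ pNorm d p x ^ q + pNorm d p y ^ q := by
  by_cases h : p = ∞
  · subst h
    exact ⟨1, one_pos, hα1, by simpa using pNorm_top_add_le⟩
  have hp' : 0 < p.toReal := ENNReal.toReal_pos hp.ne' h
  rcases le_total 1 p.toReal with h1 | h1
  · refine ⟨1, one_pos, hα1, fun x y => ?_⟩
    simpa [pNorm, h] using Real.Lp_add_le Finset.univ x y h1
  · refine ⟨p.toReal, hp', ?_, fun x y => ?_⟩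
    · rcases lt_or_ge α 0 with hα | hα
      · exact hα.trans hp'
      · exact (ENNReal.ofReal_lt_iff_lt_toReal hα h).1 hαp
    · have key (z : Fin d → ℝ) : pNorm d p z ^ p.toReal = ∑ j, |z j| ^ p.toReal := by
        rw [pNorm, if_neg h, ← Real.rpow_mul (by positivity), one_div_mul_cancel hp'.ne',
          Real.rpow_one]
      rw [key, key, key, ← Finset.sum_add_distrib]
      gcongr with j
      calc |(x + y) j| ^ p.toReal ≤ (|x j| + |y j|) ^ p.toReal := by
            gcongr
            exact abs_add_le _ _
        _ ≤ _ := Real.rpow_add_le_add_rpow (abs_nonneg _) (abs_nonneg _) hp'.le h1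

end PNorm

theorem tendsto_add_rpow_sub_rpow {θ C : ℝ} (hθ0 : 0 ≤ θ) (hθ1 : θ < 1) (hC : 0 ≤ C) :
    Tendsto (fun y : ℝ => (y + C) ^ θ - y ^ θ) atTop (nhds 0) := by
  have hlim : Tendsto (fun y : ℝ => θ * C * y ^ (-(1 - θ))) atTop (nhds 0) := by
    simpa using (tendsto_rpow_neg_atTop (sub_pos.2 hθ1)).const_mul (θ * C)
  refine squeeze_zero' ?_ ?_ hlim
  · filter_upwards [eventually_ge_atTop 0] with y hy
    exact sub_nonneg.2 (Real.rpow_le_rpow hy (by linarith) hθ0)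
  · filter_upwards [eventually_gt_atTop 0] with y hy
    have h1 : (y + C) ^ θ = y ^ θ * (1 + C / y) ^ θ := by
      rw [← Real.mul_rpow hy.le (by positivity)]
      congr 1
      field_simp
    have h2 : (1 + C / y) ^ θ ≤ 1 + θ * (C / y) :=
      rpow_one_add_le_one_add_mul_self (by linarith [show 0 ≤ C / y by positivity]) hθ0 hθ1.le
    have h3 : y ^ (-(1 - θ)) = y ^ θ / y := by
      rw [neg_sub, Real.rpow_sub_one hy.ne']
    calc (y + C) ^ θ - y ^ θ ≤ y ^ θ * (1 + θ * (C / y)) - y ^ θ := by rw [h1]; gcongr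
      _ = θ * C * y ^ (-(1 - θ)) := by rw [h3]; ring

section Cubes

variable {d : ℕ}

theorem card_le_volume_of_cubes_subset {S : Set (Fin d → ℝ)} (s : Finset (Fin d → ℤ))
    (h : ∀ k ∈ s, ∀ x : Fin d → ℝ, (∀ j, |x j - k j| ≤ 1) → x ∈ S) :
    (s.card : ℝ≥0∞) ≤ volume S := by
  let Q (k : Fin d → ℤ) : Set (Fin d → ℝ) := Set.univ.pi fun j => Set.Ico (k j : ℝ) (k j + 1)
  have hQm (k) : MeasurableSet (Q k) := MeasurableSet.univ_pi fun j => measurableSet_Ico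
  have hQv (k) : volume (Q k) = 1 := by simp [Q, Real.volume_pi_Ico]
  have hQd : Pairwise (Function.onFun Disjoint Q) := by
    intro k l hkl
    refine Set.disjoint_left.2 fun x hx hy => hkl (funext fun j => ?_)
    have hk := hx j trivial
    have hl := hy j trivial
    rw [← Int.floor_eq_iff.2 ⟨hk.1, hk.2⟩, Int.floor_eq_iff.2 ⟨hl.1, hl.2⟩]
  calc (s.card : ℝ≥0∞) = ∑ k ∈ s, volume (Q k) := by simp [hQv]
    _ = volume (⋃ k ∈ s, Q k) :=
      (measure_biUnion_finset (fun k _ l _ hkl => hQd hkl) fun k _ => hQm k).symm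
    _ ≤ volume S := by
      refine measure_mono (Set.iUnion₂_subset fun k hk x hx => h k hk x fun j => ?_)
      obtain ⟨h1, h2⟩ := hx j trivial
      rw [abs_le]
      constructor <;> linarith

theorem volume_le_card_of_subset_cubes {S : Set (Fin d → ℝ)} (s : Finset (Fin d → ℤ))
    (h : ∀ x ∈ S, ∃ k ∈ s, ∀ j, x j ∈ Set.Icc (k j : ℝ) (k j + 1)) :
    volume S ≤ s.card := by
  let Q (k : Fin d → ℤ) : Set (Fin d → ℝ) := Set.Icc (fun j => (k j : ℝ)) (fun j => k j + 1)
  have hQv (k) : volume (Q k) = 1 := by simp [Q, Real.volume_Icc_pi]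
  calc volume S ≤ volume (⋃ k ∈ s, Q k) := by
        refine measure_mono fun x hx => ?_
        obtain ⟨k, hk, hxk⟩ := h x hx
        exact Set.mem_biUnion hk ⟨fun j => (hxk j).1, fun j => (hxk j).2⟩
    _ ≤ ∑ k ∈ s, volume (Q k) := measure_biUnion_finset_le _ _
    _ = s.card := by simp [hQv]

end Cubes

section Fourier

variable {d : ℕ}

instance isFiniteMeasure_torusMeasure (d : ℕ) : IsFiniteMeasure (torusMeasure d) :=
  ⟨by
    rw [torusMeasure, Measure.restrict_apply_univ, volume_pi, Measure.pi_pi]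
    exact ENNReal.prod_lt_top fun j _ => measure_Icc_lt_top⟩

theorem continuous_torusChar (k : Fin d → ℤ) : Continuous fun x : Fin d → ℝ =>
    Complex.exp (Complex.I * ((∑ j, (k j : ℝ) * x j : ℝ) : ℂ)) := by
  fun_prop

theorem norm_torusChar (k : Fin d → ℤ) (x : Fin d → ℝ) :
    ‖Complex.exp (Complex.I * ((∑ j, (k j : ℝ) * x j : ℝ) : ℂ))‖ = 1 := by
  rw [mul_comm, Complex.norm_exp_ofReal_mul_I]

theorem memLp_torusChar (k : Fin d → ℤ) : MemLp (fun x : Fin d → ℝ =>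
    Complex.exp (Complex.I * ((∑ j, (k j : ℝ) * x j : ℝ) : ℂ))) 2 (torusMeasure d) :=
  MemLp.of_bound (continuous_torusChar k).aestronglyMeasurable 1
    (Eventually.of_forall fun x => (norm_torusChar k x).le)

/-- The normalized trigonometric monomial `(2π)^{-d/2} e^{i k·x}`. -/
def torusMonomial (k : Fin d → ℤ) : TorusL2 d :=
  (((2 * π) ^ (-(d : ℝ) / 2) : ℝ) : ℂ) • (memLp_torusChar k).toLp _

theorem integrable_mul_torusChar (f : TorusL2 d) (k : Fin d → ℤ) :
    Integrable (fun x => f x * Complex.exp (-Complex.I * ((∑ j, (k j : ℝ) * x j : ℝ) : ℂ)))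
      (torusMeasure d) := by
  have hf : Integrable f (torusMeasure d) := (Lp.memLp f).integrable (by norm_num)
  refine hf.mul_bdd (c := 1) (Continuous.aestronglyMeasurable (by fun_prop))
    (Eventually.of_forall fun x => ?_)
  rw [neg_mul, ← mul_neg, ← Complex.ofReal_neg, mul_comm, Complex.norm_exp_ofReal_mul_I]

/-- The `k`-th Fourier coefficient as a linear functional. -/
def fourierCoeffLin (k : Fin d → ℤ) : TorusL2 d →ₗ[ℂ] ℂ where
  toFun f := fourierCoeffT f k
  map_add' f g := by
    rw [fourierCoeffT, fourierCoeffT, fourierCoeffT, ← mul_add,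
      ← integral_add (integrable_mul_torusChar f k) (integrable_mul_torusChar g k)]
    congr 1
    refine integral_congr_ae ?_
    filter_upwards [Lp.coeFn_add f g] with x hx
    rw [hx, Pi.add_apply, add_mul]
  map_smul' c f := by
    simp only [fourierCoeffT, RingHom.id_apply, smul_eq_mul]
    rw [mul_left_comm, ← integral_const_mul (μ := torusMeasure d) c]
    congr 1
    refine integral_congr_ae ?_
    filter_upwards [Lp.coeFn_smul c f] with x hx
    rw [hx, Pi.smul_apply, smul_eq_mul, mul_assoc]

theorem integral_Icc_exp_int (m : ℤ) :
    ∫ x in Set.Icc 0 (2 * π), Complex.exp (Complex.I * ((m * x : ℝ) : ℂ)) =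
      if m = 0 then (2 * π : ℂ) else 0 := by
  rw [integral_Icc_eq_integral_Ioc, ← intervalIntegral.integral_of_le Real.two_pi_pos.le]
  split_ifs with hm
  · simp [hm]
  · have hc : Complex.I * m ≠ 0 := mul_ne_zero Complex.I_ne_zero (by exact_mod_cast hm)
    have := integral_exp_mul_complex (a := 0) (b := 2 * π) hc
    push_cast at this ⊢
    simp_rw [← mul_assoc]
    rw [this, show Complex.I * m * (2 * π) = m * (2 * π * Complex.I) by ring,
      Complex.exp_int_mul_two_pi_mul_I]
    simp

theorem fourierCoeffT_torusMonomial (k l : Fin d → ℤ) :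
    fourierCoeffT (torusMonomial l) k = if l = k then 1 else 0 := by
  have h1 : ∫ x, torusMonomial l x *
      Complex.exp (-Complex.I * ((∑ j, (k j : ℝ) * x j : ℝ) : ℂ)) ∂(torusMeasure d) =
      (((2 * π) ^ (-(d : ℝ) / 2) : ℝ) : ℂ) * ∫ x, ∏ j,
        Complex.exp (Complex.I * (((l j - k j : ℤ) * x j : ℝ) : ℂ)) ∂(torusMeasure d) := by
    rw [← integral_const_mul]
    refine integral_congr_ae ?_
    filter_upwards [Lp.coeFn_smul (((2 * π) ^ (-(d : ℝ) / 2) : ℝ) : ℂ)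
      ((memLp_torusChar l).toLp _), (memLp_torusChar l).coeFn_toLp] with x hx hx'
    rw [torusMonomial, hx, Pi.smul_apply, hx', smul_eq_mul, mul_assoc, ← Complex.exp_add,
      ← Complex.exp_sum]
    congr 2
    push_cast
    rw [Finset.mul_sum, Finset.mul_sum, ← Finset.sum_add_distrib]
    exact Finset.sum_congr rfl fun j _ => by ring
  have h2 : ∫ x, ∏ j, Complex.exp (Complex.I * (((l j - k j : ℤ) * x j : ℝ) : ℂ))
      ∂(torusMeasure d) = ∏ j, if l j - k j = 0 then (2 * π : ℂ) else 0 := by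
    rw [torusMeasure, volume_pi, Measure.restrict_pi_pi, integral_fintype_prod_eq_prod
      (f := fun j (x : ℝ) => Complex.exp (Complex.I * (((l j - k j : ℤ) * x : ℝ) : ℂ)))]
    exact Finset.prod_congr rfl fun j _ => integral_Icc_exp_int _
  rw [fourierCoeffT, h1, h2]
  split_ifs with hlk
  · subst hlk
    simp only [sub_self, if_true, Finset.prod_const, Finset.card_univ, Fintype.card_fin]
    rw [← mul_assoc, ← Complex.ofReal_mul, ← Real.rpow_add Real.two_pi_pos]
    rw [show -(d : ℝ) / 2 + -(d : ℝ) / 2 = -d by ring, Real.rpow_neg Real.two_pi_pos.le,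
      Real.rpow_natCast]
    push_cast
    exact inv_mul_cancel₀ (pow_ne_zero _ (by simp [Real.pi_ne_zero]))
  · obtain ⟨j, hj⟩ := Function.ne_iff.1 hlk
    rw [Finset.prod_eq_zero (Finset.mem_univ j) (if_neg (sub_ne_zero.2 hj))]
    simp

theorem fourierCoeffT_sum_smul_torusMonomial (s : Finset (Fin d → ℤ)) (b : (Fin d → ℤ) → ℂ)
    (k : Fin d → ℤ) :
    fourierCoeffT (∑ l ∈ s, b l • torusMonomial l) k = if k ∈ s then b k else 0 := by
  change fourierCoeffLin k _ = _
  rw [map_sum]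
  simp only [map_smul, smul_eq_mul]
  change ∑ l ∈ s, b l * fourierCoeffT (torusMonomial l) k = _
  simp [fourierCoeffT_torusMonomial]

end Fourier

section ApproxNumber

variable {d : ℕ}

/-- The error bound for the truncation of the Fourier series to the frequencies in `s`. -/
theorem exists_rank_lt_error_le {w : (Fin d → ℤ) → ℝ} {n : ℕ} {M : ℝ} (hM : 0 < M)
    (s : Finset (Fin d → ℤ)) (hs : s.card < n) (hw : ∀ k ∉ s, M ≤ w k) :
    ∃ A : TorusL2 d →ₗ[ℂ] TorusL2 d,
      Module.Finite ℂ (LinearMap.range A) ∧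
      Module.finrank ℂ (LinearMap.range A) < n ∧
      ∀ f : TorusL2 d, wNormSq w f ≤ 1 →
        wNormSq (constOne d) (f - A f) ≤ ENNReal.ofReal M⁻¹ ^ 2 := by
  classical
  let A : TorusL2 d →ₗ[ℂ] TorusL2 d :=
    ∑ k ∈ s, (fourierCoeffLin k).smulRight (torusMonomial k)
  have hA (f) : A f = ∑ k ∈ s, fourierCoeffT f k • torusMonomial k := by
    simp only [A, LinearMap.sum_apply, LinearMap.smulRight_apply]
    rfl
  have hrange : LinearMap.range A ≤ Submodule.span ℂ (s.image torusMonomial : Set (TorusL2 d)) := by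
    rintro _ ⟨f, rfl⟩
    rw [hA]
    exact Submodule.sum_mem _ fun k hk => Submodule.smul_mem _ _
      (Submodule.subset_span (Finset.mem_coe.2 (Finset.mem_image_of_mem _ hk)))
  refine ⟨A, Submodule.finiteDimensional_of_le hrange, ?_, fun f hf => ?_⟩
  · exact ((Submodule.finrank_mono hrange).trans (finrank_span_finset_le_card _)).trans_lt
      (Finset.card_image_le.trans_lt hs)
  · have hcoeff (k) : fourierCoeffT (f - A f) k = if k ∈ s then 0 else fourierCoeffT f k := by
      have : fourierCoeffT (f - A f) k = fourierCoeffT f k - fourierCoeffT (A f) k :=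
        map_sub (fourierCoeffLin k) f (A f)
      rw [this, hA, fourierCoeffT_sum_smul_torusMonomial]
      split_ifs <;> simp
    calc wNormSq (constOne d) (f - A f)
        ≤ ∑' k, ENNReal.ofReal M⁻¹ ^ 2 *
          ENNReal.ofReal (w k ^ 2 * ‖fourierCoeffT f k‖ ^ 2) := by
          refine ENNReal.tsum_le_tsum fun k => ?_
          rw [hcoeff, ← ENNReal.ofReal_pow (by positivity), ← ENNReal.ofReal_mul (by positivity)]
          refine ENNReal.ofReal_le_ofReal ?_
          split_ifs with hk
          · simp only [norm_zero]
            rw [zero_pow two_ne_zero, mul_zero]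
            positivity
          · have h1 : 1 ≤ M⁻¹ * w k := by
              rw [inv_mul_eq_div, one_le_div hM]
              exact hw k hk
            rw [constOne, one_pow, ← mul_assoc, ← mul_pow]
            gcongr
            exact one_le_pow₀ h1
      _ = ENNReal.ofReal M⁻¹ ^ 2 * wNormSq w f := ENNReal.tsum_mul_left
      _ ≤ ENNReal.ofReal M⁻¹ ^ 2 := mul_le_of_le_one_right' hf

theorem approxNumber_le {w : (Fin d → ℤ) → ℝ} {n : ℕ} {M : ℝ} (hM : 0 < M)
    (s : Finset (Fin d → ℤ)) (hs : s.card < n) (hw : ∀ k ∉ s, M ≤ w k) :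
    approxNumber d w (constOne d) n ≤ M⁻¹ :=
  csInf_le ⟨0, fun _ hr => hr.1⟩ ⟨by positivity, exists_rank_lt_error_le hM s hs hw⟩

theorem wNormSq_sum_smul_torusMonomial (w : (Fin d → ℤ) → ℝ) (s : Finset (Fin d → ℤ))
    (b : (Fin d → ℤ) → ℂ) :
    wNormSq w (∑ k ∈ s, b k • torusMonomial k) =
      ENNReal.ofReal (∑ k ∈ s, w k ^ 2 * ‖b k‖ ^ 2) := by
  rw [wNormSq, tsum_eq_sum (s := s), ENNReal.ofReal_sum_of_nonneg fun k _ => by positivity]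
  · refine Finset.sum_congr rfl fun k hk => ?_
    rw [fourierCoeffT_sum_smul_torusMonomial, if_pos hk]
  · intro k hk
    rw [fourierCoeffT_sum_smul_torusMonomial, if_neg hk]
    simp

theorem le_approxNumber {w : (Fin d → ℤ) → ℝ} {n : ℕ} {M : ℝ} (hM : 0 < M) (hn : 0 < n)
    (s : Finset (Fin d → ℤ)) (hs : n ≤ s.card) (hw1 : ∀ k, 1 ≤ w k)
    (hw : ∀ k ∈ s, w k ≤ M) :
    M⁻¹ ≤ approxNumber d w (constOne d) n := by
  refine le_csInf ⟨1⁻¹, by positivity, exists_rank_lt_error_le one_pos ∅ (by simpa) fun k _ =>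
    hw1 k⟩ ?_
  rintro r ⟨hr, A, hfin, hrank, hA⟩
  let L : (s → ℂ) →ₗ[ℂ] LinearMap.range A :=
    A.rangeRestrict ∘ₗ Fintype.linearCombination ℂ fun k : s => torusMonomial (k : Fin d → ℤ)
  have hker : LinearMap.ker L ≠ ⊥ := by
    refine LinearMap.ker_ne_bot_of_finrank_lt ?_
    simpa using hrank.trans_le hs
  obtain ⟨c, hc, hc0⟩ := Submodule.exists_mem_ne_zero_of_ne_bot hker
  let b : (Fin d → ℤ) → ℂ := fun k => if hk : k ∈ s then c ⟨k, hk⟩ else 0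
  have hAb : A (∑ k ∈ s, b k • torusMonomial k) = 0 := by
    have h1 := congrArg Subtype.val (LinearMap.mem_ker.1 hc)
    rw [← Finset.sum_coe_sort s]
    simpa [L, b, Fintype.linearCombination_apply] using h1
  have hS : 0 < ∑ k ∈ s, ‖b k‖ ^ 2 := by
    obtain ⟨k, hk⟩ := Function.ne_iff.1 hc0
    refine Finset.sum_pos' (fun _ _ => by positivity) ⟨k, k.2, ?_⟩
    have : b k = c k := by simp [b]
    rw [this]
    exact pow_pos (norm_pos_iff.2 hk) 2
  set S := ∑ k ∈ s, ‖b k‖ ^ 2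
  let t : ℝ := (M * √S)⁻¹
  have ht : 0 < t := by positivity
  have htS : t ^ 2 * S = M⁻¹ ^ 2 := by
    simp only [t]
    rw [mul_inv, mul_pow, inv_pow (√S), Real.sq_sqrt hS.le]
    field_simp
  have hnorm (k) : ‖(t : ℂ) * b k‖ ^ 2 = t ^ 2 * ‖b k‖ ^ 2 := by
    rw [norm_mul, Complex.norm_real, Real.norm_of_nonneg ht.le, mul_pow]
  have hAt : A (∑ k ∈ s, ((t : ℂ) * b k) • torusMonomial k) = 0 := by
    simp_rw [mul_smul]
    rw [← Finset.smul_sum, map_smul, hAb, smul_zero]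
  have hbound := hA (∑ k ∈ s, ((t : ℂ) * b k) • torusMonomial k) (by
    rw [wNormSq_sum_smul_torusMonomial, ← ENNReal.ofReal_one]
    refine ENNReal.ofReal_le_ofReal ?_
    calc ∑ k ∈ s, w k ^ 2 * ‖(t : ℂ) * b k‖ ^ 2 ≤ ∑ k ∈ s, M ^ 2 * (t ^ 2 * ‖b k‖ ^ 2) := by
          refine Finset.sum_le_sum fun k hk => ?_
          rw [hnorm]
          gcongr
          exacts [zero_le_one.trans (hw1 k), hw k hk]
      _ = M ^ 2 * (t ^ 2 * S) := by rw [← Finset.mul_sum, ← Finset.mul_sum]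
      _ = 1 := by rw [htS]; field_simp)
  rw [hAt, sub_zero, wNormSq_sum_smul_torusMonomial, ← ENNReal.ofReal_pow hr,
    ENNReal.ofReal_le_ofReal_iff (by positivity)] at hbound
  simp only [constOne, one_pow, one_mul, hnorm] at hbound
  rw [← Finset.mul_sum, htS] at hbound
  exact le_of_sq_le_sq hbound hr

end ApproxNumber

section UnitBall

variable {d : ℕ} {p : ℝ≥0∞}

theorem volume_unitBallP_lt_top (hp : 0 < p) : volume (unitBallP d p) < ∞ := by
  refine (measure_mono (t := Set.Icc (fun _ => -1) fun _ => 1) fun x hx => ?_).trans_lt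
    measure_Icc_lt_top
  have h (j) : |x j| ≤ 1 := (abs_le_pNorm hp x j).trans hx
  exact ⟨fun j => (abs_le.1 (h j)).1, fun j => (abs_le.1 (h j)).2⟩

theorem volume_unitBallP_pos (hp : 0 < p) : 0 < volume (unitBallP d p) := by
  set c := pNorm d p fun _ => 1
  have hc : 0 ≤ c := pNorm_nonneg _
  refine lt_of_lt_of_le ?_ (measure_mono (s := Metric.ball 0 (1 + c)⁻¹) fun x hx => ?_)
  · exact Metric.measure_ball_pos _ _ (by positivity)
  · have hx' (j) : |x j| ≤ (1 + c)⁻¹ := by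
      simpa using (norm_le_pi_norm x j).trans (mem_ball_zero_iff.1 hx).le
    calc pNorm d p x ≤ pNorm d p ((1 + c)⁻¹ • fun _ => 1) := by
          refine pNorm_mono fun j => ?_
          simpa [abs_of_pos (show 0 < 1 + c by positivity)] using hx' j
      _ = (1 + c)⁻¹ * c := pNorm_smul hp (by positivity) _
      _ ≤ 1 := by
          rw [inv_mul_le_one₀ (by positivity)]
          linarith

open scoped Pointwise in
theorem setOf_pNorm_le_eq_smul (hp : 0 < p) {r : ℝ} (hr : 0 < r) :
    {x | pNorm d p x ≤ r} = r • unitBallP d p := by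
  ext x
  rw [Set.mem_smul_set_iff_inv_smul_mem₀ hr.ne', unitBallP, Set.mem_ofPred_eq, Set.mem_ofPred_eq,
    pNorm_smul hp (by positivity), inv_mul_le_one₀ hr]

theorem volume_pNorm_le (hp : 0 < p) {r : ℝ} (hr : 0 < r) :
    volume {x | pNorm d p x ≤ r} =
      ENNReal.ofReal (r ^ d * (volume (unitBallP d p)).toReal) := by
  rw [setOf_pNorm_le_eq_smul hp hr, Measure.addHaar_smul_of_nonneg _ hr.le,
    ENNReal.ofReal_mul (by positivity), ENNReal.ofReal_toReal (volume_unitBallP_lt_top hp).ne]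
  simp

theorem finite_pNorm_int_le (hp : 0 < p) (r : ℝ) :
    {k : Fin d → ℤ | pNorm d p (fun j => (k j : ℝ)) ≤ r}.Finite := by
  refine (Set.finite_Icc (fun _ => -⌈r⌉) fun _ => ⌈r⌉).subset fun k hk => ?_
  have h (j) : |k j| ≤ ⌈r⌉ := by
    have h1 : |(k j : ℝ)| ≤ r := (abs_le_pNorm hp (fun j => (k j : ℝ)) j).trans hk
    exact_mod_cast h1.trans (Int.le_ceil r)
  exact ⟨fun j => (abs_le.1 (h j)).1, fun j => (abs_le.1 (h j)).2⟩

/-- The finite set of integer points `k` with `‖k‖_p ≤ r`. -/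
def gridBall (d : ℕ) (hp : 0 < p) (r : ℝ) : Finset (Fin d → ℤ) :=
  (finite_pNorm_int_le (d := d) hp r).toFinset

theorem mem_gridBall (hp : 0 < p) {r : ℝ} {k : Fin d → ℤ} :
    k ∈ gridBall d hp r ↔ pNorm d p (fun j => (k j : ℝ)) ≤ r :=
  Set.Finite.mem_toFinset _

variable {q : ℝ}

theorem pNorm_le_of_add_rpow_le (hq : 0 < q)
    (hadd : ∀ x y : Fin d → ℝ, pNorm d p (x + y) ^ q ≤ pNorm d p x ^ q + pNorm d p y ^ q)
    {x y : Fin d → ℝ} (hxy : ∀ j, |y j - x j| ≤ 1) {r : ℝ} (hr : 0 ≤ r)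
    (hx : pNorm d p x ≤ r) :
    pNorm d p y ≤ (r ^ q + pNorm d p (fun _ => 1) ^ q) ^ q⁻¹ := by
  rw [Real.le_rpow_inv_iff_of_pos (pNorm_nonneg _)
    (add_nonneg (by positivity) (Real.rpow_nonneg (pNorm_nonneg _) _)) hq]
  calc pNorm d p y ^ q = pNorm d p (x + (y - x)) ^ q := by rw [add_sub_cancel]
    _ ≤ pNorm d p x ^ q + pNorm d p (y - x) ^ q := hadd _ _
    _ ≤ r ^ q + pNorm d p (fun _ => 1) ^ q := by
      have h := pNorm_nonneg (p := p) x
      have h' := pNorm_nonneg (p := p) (y - x)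
      gcongr
      exact pNorm_mono fun j => by simpa using hxy j

theorem card_gridBall_le (hp : 0 < p) (hq : 0 < q)
    (hadd : ∀ x y : Fin d → ℝ, pNorm d p (x + y) ^ q ≤ pNorm d p x ^ q + pNorm d p y ^ q)
    {r : ℝ} (hr : 0 < r) :
    ((gridBall d hp r).card : ℝ) ≤ ((r ^ q + pNorm d p (fun _ => 1) ^ q) ^ q⁻¹) ^ d *
      (volume (unitBallP d p)).toReal := by
  have hpos : 0 < (r ^ q + pNorm d p (fun _ => 1) ^ q) ^ q⁻¹ :=
    Real.rpow_pos_of_pos (add_pos_of_pos_of_nonneg (by positivity)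
      (Real.rpow_nonneg (pNorm_nonneg _) _)) _
  have h := card_le_volume_of_cubes_subset (gridBall d hp r) fun k hk x hx =>
    pNorm_le_of_add_rpow_le hq hadd hx hr.le ((mem_gridBall hp).1 hk)
  change _ ≤ volume {x | pNorm d p x ≤ _} at h
  rw [volume_pNorm_le hp hpos] at h
  have := ENNReal.toReal_le_of_le_ofReal (by positivity) h
  simpa using this

theorem le_card_gridBall (hp : 0 < p) (hq : 0 < q)
    (hadd : ∀ x y : Fin d → ℝ, pNorm d p (x + y) ^ q ≤ pNorm d p x ^ q + pNorm d p y ^ q)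
    {r : ℝ} (hr : 0 < r) :
    r ^ d * (volume (unitBallP d p)).toReal ≤
      (gridBall d hp ((r ^ q + pNorm d p (fun _ => 1) ^ q) ^ q⁻¹)).card := by
  have h := volume_le_card_of_subset_cubes (S := {x | pNorm d p x ≤ r})
    (gridBall d hp ((r ^ q + pNorm d p (fun _ => 1) ^ q) ^ q⁻¹)) fun x hx =>
      ⟨fun j => ⌊x j⌋, (mem_gridBall hp).2 (pNorm_le_of_add_rpow_le hq hadd (x := x) (fun j => by
        rw [abs_le]
        constructor <;> linarith [Int.floor_le (x j), Int.lt_floor_add_one (x j)]) hr.le hx),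
        fun j => ⟨Int.floor_le _, (Int.lt_floor_add_one _).le⟩⟩
  rw [volume_pNorm_le hp hr] at h
  simpa using ENNReal.ofReal_le_iff_le_toReal (by simp) |>.1 h

end UnitBall

section Gevrey

variable {d : ℕ} {p : ℝ≥0∞} {α β q : ℝ}

theorem one_le_wGevrey (hβ : 0 ≤ β) (k : Fin d → ℤ) : 1 ≤ wGevrey d α β p k :=
  Real.one_le_exp (mul_nonneg hβ (Real.rpow_nonneg (pNorm_nonneg _) _))

theorem approxNumber_wGevrey_le (hp : 0 < p) (hα : 0 ≤ α) (hβ : 0 ≤ β) (hd : 0 < d) (hq : 0 < q)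
    (hadd : ∀ x y : Fin d → ℝ, pNorm d p (x + y) ^ q ≤ pNorm d p x ^ q + pNorm d p y ^ q)
    {n : ℕ} {y u : ℝ} (hu : 0 < u) (huy : u + pNorm d p (fun _ => 1) ^ q < y)
    (hy : (y ^ q⁻¹) ^ d * (volume (unitBallP d p)).toReal = n) :
    approxNumber d (wGevrey d α β p) (constOne d) n ≤ Real.exp (-(β * u ^ (α / q))) := by
  have hV : 0 < (volume (unitBallP d p)).toReal :=
    ENNReal.toReal_pos (volume_unitBallP_pos hp).ne' (volume_unitBallP_lt_top hp).ne
  have hC : 0 ≤ pNorm d p (fun _ : Fin d => (1 : ℝ)) ^ q := Real.rpow_nonneg (pNorm_nonneg _) _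
  have hr : 0 < u ^ q⁻¹ := by positivity
  rw [Real.exp_neg]
  refine approxNumber_le (Real.exp_pos _) (gridBall d hp (u ^ q⁻¹)) ?_ fun k hk => ?_
  · have h := card_gridBall_le hp hq hadd hr
    rw [Real.rpow_inv_rpow hu.le hq.ne'] at h
    have h' : ((u + pNorm d p (fun _ => 1) ^ q) ^ q⁻¹) ^ d * (volume (unitBallP d p)).toReal <
        (y ^ q⁻¹) ^ d * (volume (unitBallP d p)).toReal := by
      gcongr
    exact_mod_cast h.trans_lt (h'.trans_eq hy)
  · rw [mem_gridBall, not_le] at hk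
    rw [wGevrey, div_eq_inv_mul, Real.rpow_mul hu.le]
    gcongr

theorem le_approxNumber_wGevrey (hp : 0 < p) (hα : 0 ≤ α) (hβ : 0 ≤ β) (hq : 0 < q)
    (hadd : ∀ x y : Fin d → ℝ, pNorm d p (x + y) ^ q ≤ pNorm d p x ^ q + pNorm d p y ^ q)
    {n : ℕ} (hn : 0 < n) {y : ℝ} (hy0 : 0 < y)
    (hy : (y ^ q⁻¹) ^ d * (volume (unitBallP d p)).toReal = n) :
    Real.exp (-(β * (y + pNorm d p (fun _ => 1) ^ q) ^ (α / q))) ≤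
      approxNumber d (wGevrey d α β p) (constOne d) n := by
  have hC : 0 ≤ pNorm d p (fun _ : Fin d => (1 : ℝ)) ^ q := Real.rpow_nonneg (pNorm_nonneg _) _
  rw [Real.exp_neg]
  refine le_approxNumber (Real.exp_pos _) hn
    (gridBall d hp ((y + pNorm d p (fun _ => 1) ^ q) ^ q⁻¹)) ?_ (one_le_wGevrey hβ)
    fun k hk => ?_
  · have h := le_card_gridBall hp hq hadd (r := y ^ q⁻¹) (by positivity)
    rw [Real.rpow_inv_rpow hy0.le hq.ne', hy] at h
    exact_mod_cast h
  · rw [mem_gridBall] at hk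
    rw [wGevrey, div_eq_inv_mul, Real.rpow_mul (by positivity)]
    have := pNorm_nonneg (p := p) fun j => (k j : ℝ)
    gcongr

end Gevrey

/-- `lim_n a_n(Id : G^{α,β,p}(T^d) → L2(T^d)) · exp(β vol(B_p^d)^{-α/d} n^{α/d}) = 1`
for `0 < α < min{1,p}`. -/
theorem statement14 (p : ℝ≥0∞) (hp : 0 < p) (α : ℝ) (hα0 : 0 < α) (hα1 : α < 1)
    (hαp : ENNReal.ofReal α < p) (β : ℝ) (hβ : 0 < β) (d : ℕ) (hd : 0 < d) :
    Filter.Tendsto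
      (fun n : ℕ =>
        approxNumber d (wGevrey d α β p) (constOne d) n *
          Real.exp (β * (volume (unitBallP d p)).toReal ^ (-(α / (d : ℝ))) *
            (n : ℝ) ^ (α / (d : ℝ))))
      Filter.atTop (nhds 1) := by
  obtain ⟨q, hq, hαq, hadd⟩ := exists_pNorm_add_rpow_le (d := d) hp hα1 hαp
  set V := (volume (unitBallP d p)).toReal
  set C := pNorm d p (fun _ : Fin d => (1 : ℝ)) ^ q
  have hV : 0 < V := ENNReal.toReal_pos (volume_unitBallP_pos hp).ne' (volume_unitBallP_lt_top hp).ne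
  have hC : 0 ≤ C := Real.rpow_nonneg (pNorm_nonneg _) _
  have hd' : (0 : ℝ) < d := by exact_mod_cast hd
  have hθ0 : 0 ≤ α / q := by positivity
  have hθ1 : α / q < 1 := (div_lt_one hq).2 hαq
  let y : ℕ → ℝ := fun n => (n / V) ^ (q / d)
  have hy0 (n) : 0 ≤ y n := by positivity
  have hyV (n : ℕ) : (y n ^ q⁻¹) ^ d * V = n := by
    rw [← Real.rpow_natCast, ← Real.rpow_mul (hy0 n), ← Real.rpow_mul (by positivity),
      show q / d * (q⁻¹ * d) = 1 by field_simp, Real.rpow_one, div_mul_cancel₀ _ hV.ne']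
  have hyα (n : ℕ) : β * V ^ (-(α / (d : ℝ))) * (n : ℝ) ^ (α / (d : ℝ)) =
      β * y n ^ (α / q) := by
    rw [← Real.rpow_mul (by positivity), show q / d * (α / q) = α / d by field_simp,
      Real.div_rpow (by positivity) hV.le, Real.rpow_neg hV.le]
    ring
  have hytop : Tendsto y atTop atTop :=
    (tendsto_rpow_atTop (by positivity)).comp (tendsto_natCast_atTop_atTop.atTop_div_const hV)
  have hlow : Tendsto (fun n => Real.exp (-(β * ((y n + C) ^ (α / q) - y n ^ (α / q)))))
      atTop (nhds 1) := by
    simpa using ((((tendsto_add_rpow_sub_rpow hθ0 hθ1 hC).comp hytop).const_mul β).neg).rexp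
  have hup : Tendsto (fun n => Real.exp (β * (y n ^ (α / q) - (y n - (C + 1)) ^ (α / q))))
      atTop (nhds 1) := by
    have h := ((tendsto_add_rpow_sub_rpow hθ0 hθ1 (add_nonneg hC zero_le_one)).comp
      (tendsto_atTop_add_const_right _ (-(C + 1)) hytop)).const_mul β |>.rexp
    simpa only [Function.comp_def, ← sub_eq_add_neg (y _), sub_add_cancel, mul_zero,
      Real.exp_zero] using h
  refine tendsto_of_tendsto_of_tendsto_of_le_of_le' hlow hup ?_ ?_
  · filter_upwards [eventually_gt_atTop 0, hytop.eventually_gt_atTop 0] with n hn hyn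
    rw [hyα]
    calc Real.exp (-(β * ((y n + C) ^ (α / q) - y n ^ (α / q))))
        = Real.exp (-(β * (y n + C) ^ (α / q))) * Real.exp (β * y n ^ (α / q)) := by
          rw [← Real.exp_add]
          ring_nf
      _ ≤ _ := by
          gcongr
          exact le_approxNumber_wGevrey hp hα0.le hβ.le hq hadd hn hyn (hyV n)
  · filter_upwards [hytop.eventually_gt_atTop (C + 1)] with n hyn
    rw [hyα]
    calc _ ≤ Real.exp (-(β * (y n - (C + 1)) ^ (α / q))) * Real.exp (β * y n ^ (α / q)) := by
          gcongr
          exact approxNumber_wGevrey_le hp hα0.le hβ.le hd hq hadd (sub_pos.2 hyn)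
            (show y n - (C + 1) + C < y n by linarith) (hyV n)
      _ = _ := by
          rw [← Real.exp_add]
          ring_nf

end
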